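/- For every ε with 0 < ε ≤ 1, the operator norm of T_ε − T_0 equals ε, yet the Hausdorff distance between spec(T_ε) and spec(T_0) equals 1. In particular, an arbitrarily small perturbation of T_0 completely changes its spectrum (spectral instability). -/

import Mathlib

open scoped ENNReal

section WeightedComposition

variable {ι : Type*}

theorem memlp_two_weighted_comp (w : ι → ℂ) {C : ℝ} (hw : ∀ n, ‖w n‖ ≤ C)
    (σ : ι ≃ ι) (f : lp (fun _ : ι => ℂ) 2) : Memℓp (fun n => w n * f (σ n)) 2 := by
  have hf := (lp.memℓp f).summable (by norm_num)
  have hfσ := σ.summable_iff.mpr hf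
  refine memℓp_gen ((hfσ.mul_left (C ^ (2 : ℝ≥0∞).toReal)).of_nonneg_of_le
    (fun n => by positivity) fun n => ?_)
  have hC : 0 ≤ C := (norm_nonneg _).trans (hw n)
  rw [norm_mul, Real.mul_rpow (norm_nonneg _) (norm_nonneg _)]
  simp only [Function.comp_apply]
  gcongr
  exact hw n

theorem norm_le_of_apply_le_comp {C : ℝ} (hC : 0 ≤ C) (σ : ι ≃ ι) {f g : lp (fun _ : ι => ℂ) 2}
    (h : ∀ n, ‖g n‖ ≤ C * ‖f (σ n)‖) : ‖g‖ ≤ C * ‖f‖ := by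
  have hp : 0 < (2 : ℝ≥0∞).toReal := by norm_num
  have hf := lp.hasSum_norm hp f
  have hfσ := (σ.hasSum_iff.mpr hf).mul_left (C ^ (2 : ℝ≥0∞).toReal)
  refine lp.norm_le_of_tsum_le hp (by positivity) ?_
  rw [Real.mul_rpow hC (norm_nonneg _), ← hfσ.tsum_eq]
  refine ((lp.memℓp g).summable hp).tsum_le_tsum (fun n => ?_) hfσ.summable
  rw [Function.comp_apply, ← Real.mul_rpow hC (norm_nonneg _)]
  exact Real.rpow_le_rpow (norm_nonneg _) (h n) hp.le

/-- The weighted composition operator `f ↦ (n ↦ w n * f (σ n))` on `ℓ²`. -/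
noncomputable def weightedComp (w : ι → ℂ) (C : ℝ) (hC : 0 ≤ C) (hw : ∀ n, ‖w n‖ ≤ C) (σ : ι ≃ ι) :
    lp (fun _ : ι => ℂ) 2 →L[ℂ] lp (fun _ : ι => ℂ) 2 :=
  LinearMap.mkContinuous
    { toFun f := ⟨fun n => w n * f (σ n), memlp_two_weighted_comp w hw σ f⟩
      map_add' f g := by ext n; exact mul_add ..
      map_smul' c f := by ext n; exact mul_left_comm .. }
    C fun f => norm_le_of_apply_le_comp hC σ fun n => by
      simpa using mul_le_mul_of_nonneg_right (hw n) (norm_nonneg (f (σ n)))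

@[simp]
theorem weightedComp_apply (w : ι → ℂ) (C : ℝ) (hC : 0 ≤ C) (hw : ∀ n, ‖w n‖ ≤ C) (σ : ι ≃ ι)
    (f : lp (fun _ : ι => ℂ) 2) (n : ι) : weightedComp w C hC hw σ f n = w n * f (σ n) :=
  rfl

theorem norm_le_one_of_apply_le_comp (A : lp (fun _ : ι => ℂ) 2 →L[ℂ] lp (fun _ : ι => ℂ) 2)
    (σ : ι ≃ ι) (h : ∀ f n, ‖A f n‖ ≤ ‖f (σ n)‖) : ‖A‖ ≤ 1 :=
  A.opNorm_le_bound zero_le_one fun f =>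
    norm_le_of_apply_le_comp zero_le_one σ fun n => by simpa using h f n

end WeightedComposition

theorem norm_le_of_mem_spectrum {E : Type*} [NormedAddCommGroup E] [NormedSpace ℂ E]
    [CompleteSpace E] {A : E →L[ℂ] E} {z : ℂ} (hz : z ∈ spectrum ℂ A) : ‖z‖ ≤ ‖A‖ :=
  (spectrum.norm_le_norm_mul_of_mem hz).trans
    (mul_le_of_le_one_right (norm_nonneg _) ContinuousLinearMap.norm_id_le)

theorem spectrum_subset_sphere_of_norm_le_one {E : Type*} [NormedAddCommGroup E]
    [NormedSpace ℂ E] [CompleteSpace E] (U : (E →L[ℂ] E)ˣ) (hU : ‖(U : E →L[ℂ] E)‖ ≤ 1)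
    (hUinv : ‖((U⁻¹ : (E →L[ℂ] E)ˣ) : E →L[ℂ] E)‖ ≤ 1) :
    spectrum ℂ (U : E →L[ℂ] E) ⊆ Metric.sphere 0 1 := by
  intro z hz
  have h1 := (norm_le_of_mem_spectrum hz).trans hU
  have h2 := (norm_le_of_mem_spectrum (spectrum.inv₀_mem_inv_iff.mpr hz)).trans hUinv
  have hz0 : z ≠ 0 := spectrum.ne_zero_of_mem_of_unit hz
  rw [norm_inv, inv_le_one₀ (norm_pos_iff.mpr hz0)] at h2
  simpa using le_antisymm h1 h2

theorem spectrum_perturbed_shift_subset {ε : ℝ} (hε0 : 0 < ε)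
    {T : lp (fun _ : ℤ => ℂ) 2 →L[ℂ] lp (fun _ : ℤ => ℂ) 2}
    (hT : ∀ (f : lp (fun _ : ℤ => ℂ) 2) (n : ℤ),
      T f n = if n = 0 then (ε : ℂ) * f 1 else f (n + 1)) :
    spectrum ℂ T ⊆ Metric.sphere 0 1 := by
  have hε : (ε : ℂ) ≠ 0 := by exact_mod_cast hε0.ne'
  let shift (k : ℤ) := weightedComp (fun _ : ℤ => 1) 1 zero_le_one (by simp) (Equiv.addRight k)
  let U : (lp (fun _ : ℤ => ℂ) 2 →L[ℂ] lp (fun _ : ℤ => ℂ) 2)ˣ :=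
    ⟨shift 1, shift (-1), by ext f n; simp [shift], by ext f n; simp [shift]⟩
  have bound (c : ℝ) (n : ℤ) : ‖if 1 ≤ n then (c : ℂ) else 1‖ ≤ max |c| 1 := by
    split_ifs <;> simp
  let diag (c : ℝ) := weightedComp (fun n : ℤ => if 1 ≤ n then (c : ℂ) else 1) (max |c| 1)
    (by positivity) (bound c) (Equiv.refl ℤ)
  let D : (lp (fun _ : ℤ => ℂ) 2 →L[ℂ] lp (fun _ : ℤ => ℂ) 2)ˣ :=
    ⟨diag ε, diag ε⁻¹, by ext f n; by_cases h : 1 ≤ n <;> simp [diag, h, hε],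
      by ext f n; by_cases h : 1 ≤ n <;> simp [diag, h, hε]⟩
  have hconj : (D : lp (fun _ : ℤ => ℂ) 2 →L[ℂ] lp (fun _ : ℤ => ℂ) 2) * T = U * D := by
    ext f n
    have hd : (D * T : lp (fun _ : ℤ => ℂ) 2 →L[ℂ] lp (fun _ : ℤ => ℂ) 2) f n =
      (if 1 ≤ n then (ε : ℂ) else 1) * T f n := rfl
    have hu : (U * D : lp (fun _ : ℤ => ℂ) 2 →L[ℂ] lp (fun _ : ℤ => ℂ) 2) f n =
      1 * ((if 1 ≤ n + 1 then (ε : ℂ) else 1) * f (n + 1)) := rfl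
    rw [hd, hu, hT]
    rcases lt_trichotomy n 0 with h | rfl | h
    · simp [h.ne, show ¬ 1 ≤ n by omega, show ¬ 0 ≤ n by omega]
    · simp
    · simp [h.ne', show 1 ≤ n by omega, show 0 ≤ n by omega]
  have : T = ↑D⁻¹ * ↑U * ↑D := by rw [mul_assoc, ← hconj, Units.inv_mul_cancel_left]
  rw [this, spectrum.units_conjugate']
  refine spectrum_subset_sphere_of_norm_le_one U ?_ ?_
  · exact norm_le_one_of_apply_le_comp _ (Equiv.addRight 1) fun f n => by simp [U, shift]
  · exact norm_le_one_of_apply_le_comp _ (Equiv.addRight (-1)) fun f n => by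
      change ‖shift (-1) f n‖ ≤ _
      simp [shift]

theorem lp_two_tendsto_cofinite_zero {ι : Type*} (f : lp (fun _ : ι => ℂ) 2) :
    Filter.Tendsto (fun n => ‖f n‖) Filter.cofinite (nhds 0) := by
  have h := ((lp.memℓp f).summable (by norm_num)).tendsto_cofinite_zero
  have h2 := h.sqrt
  simpa [Real.sqrt_sq] using h2

theorem lp_two_apply_eq_zero_of_norm_eq {ι : Type*} (f : lp (fun _ : ι => ℂ) 2) {a : ι}
    {e : ℕ → ι} (he : e.Injective) (h : ∀ k, ‖f (e k)‖ = ‖f a‖) : f a = 0 := by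
  have := (lp_two_tendsto_cofinite_zero f).comp he.tendsto_cofinite
  simp only [Function.comp_def, h, tendsto_const_nhds_iff] at this
  simpa using this

theorem sphere_subset_spectrum_perturbed_shift {ε : ℝ}
    {T : lp (fun _ : ℤ => ℂ) 2 →L[ℂ] lp (fun _ : ℤ => ℂ) 2}
    (hT : ∀ (f : lp (fun _ : ℤ => ℂ) 2) (n : ℤ),
      T f n = if n = 0 then (ε : ℂ) * f 1 else f (n + 1)) :
    Metric.sphere 0 1 ⊆ spectrum ℂ T := by
  intro z hz
  have hz : ‖z‖ = 1 := by simpa using hz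
  rw [spectrum.mem_iff]
  rintro ⟨V, hV⟩
  set f := (↑V⁻¹ : lp (fun _ : ℤ => ℂ) 2 →L[ℂ] lp (fun _ : ℤ => ℂ) 2) (lp.single 2 0 1) with hf
  have hVf : (V : lp (fun _ : ℤ => ℂ) 2 →L[ℂ] lp (fun _ : ℤ => ℂ) 2) f = lp.single 2 0 1 := by
    rw [hf, ← mul_apply_eq_comp, Units.mul_inv, one_apply_eq_self]
  have hn (n : ℤ) : z * f n - T f n = if n = 0 then 1 else 0 := by
    have := congrArg (fun g : lp (fun _ : ℤ => ℂ) 2 => g n) hVf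
    rw [hV] at this
    exact this.trans (by simp [lp.single_apply, Pi.single_apply])
  have hstep (n : ℤ) (h : n ≠ 0) : ‖f (n + 1)‖ = ‖f n‖ := by
    have := hn n
    rw [hT, if_neg h, if_neg h, sub_eq_zero] at this
    rw [← this, norm_mul, hz, one_mul]
  have h1 : f 1 = 0 := by
    refine lp_two_apply_eq_zero_of_norm_eq f (e := fun k : ℕ => 1 + (k : ℤ))
      (fun a b h => by simpa using h) fun k => ?_
    induction k with
    | zero => simp
    | succ k ih => rw [← ih, ← hstep (1 + k) (by omega)]; push_cast; rw [add_assoc]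
  have h0 : f 0 = 0 := by
    refine lp_two_apply_eq_zero_of_norm_eq f (e := fun k : ℕ => -(k : ℤ))
      (fun a b h => by simpa using h) fun k => ?_
    induction k with
    | zero => simp
    | succ k ih => rw [← ih, ← hstep (-(k + 1 : ℕ)) (by omega), show -((k + 1 : ℕ) : ℤ) + 1 = -k by omega]
  have := hn 0
  simp [hT, h0, h1] at this

theorem summable_int_of_nat_succ {g : ℤ → ℝ} (h0 : ∀ n ≤ 0, g n = 0)
    (h : Summable fun k : ℕ => g (k + 1)) : Summable g := by
  have hinj : Function.Injective fun k : ℕ => (k : ℤ) + 1 := fun a b h => by simpa using h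
  refine (hinj.summable_iff fun n hn => h0 n ?_).mp h
  by_contra! hpos
  exact hn ⟨(n - 1).toNat, by simp; omega⟩

theorem mem_spectrum_truncated_shift {T : lp (fun _ : ℤ => ℂ) 2 →L[ℂ] lp (fun _ : ℤ => ℂ) 2}
    (hT : ∀ (f : lp (fun _ : ℤ => ℂ) 2) (n : ℤ), T f n = if n = 0 then 0 else f (n + 1))
    {z : ℂ} (hz : ‖z‖ < 1) : z ∈ spectrum ℂ T := by
  have hmem : Memℓp (fun n : ℤ => if 1 ≤ n then z ^ (n - 1).toNat else 0) 2 := by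
    refine memℓp_gen (summable_int_of_nat_succ (fun n hn => ?_) ?_)
    · simp [show ¬ 1 ≤ n by omega]
    · have := summable_geometric_of_lt_one (by positivity : 0 ≤ ‖z‖ ^ 2)
        (pow_lt_one₀ (norm_nonneg _) hz two_ne_zero)
      simpa [← pow_mul, mul_comm] using this
  let f : lp (fun _ : ℤ => ℂ) 2 := ⟨_, hmem⟩
  have hfapp (n : ℤ) : f n = if 1 ≤ n then z ^ (n - 1).toNat else 0 := rfl
  have hf0 : f ≠ 0 := fun h => by
    have := congrArg (fun g : lp (fun _ : ℤ => ℂ) 2 => g 1) h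
    simp [hfapp] at this
  rw [spectrum.mem_iff]
  rintro ⟨V, hV⟩
  have hVf : (V : lp (fun _ : ℤ => ℂ) 2 →L[ℂ] lp (fun _ : ℤ => ℂ) 2) f = 0 := by
    ext n
    rw [hV]
    change z * f n - T f n = 0
    rw [hT, hfapp, hfapp]
    rcases lt_trichotomy n 0 with h | rfl | h
    · simp [h.ne, show ¬ 1 ≤ n by omega, show ¬ 0 ≤ n by omega]
    · simp
    · obtain ⟨k, rfl⟩ : ∃ k : ℕ, n = k + 1 := ⟨(n - 1).toNat, by omega⟩
      simp [h.ne', show (0 : ℤ) ≤ k + 1 by omega, show ((k : ℤ) + 1).toNat = k + 1 by omega,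
        pow_succ']
  apply hf0
  have := congrArg (↑V⁻¹ : lp (fun _ : ℤ => ℂ) 2 →L[ℂ] lp (fun _ : ℤ => ℂ) 2) hVf
  rwa [map_zero, ← mul_apply_eq_comp, Units.inv_mul,
    one_apply_eq_self] at this

theorem spectrum_truncated_shift {T : lp (fun _ : ℤ => ℂ) 2 →L[ℂ] lp (fun _ : ℤ => ℂ) 2}
    (hT : ∀ (f : lp (fun _ : ℤ => ℂ) 2) (n : ℤ), T f n = if n = 0 then 0 else f (n + 1)) :
    spectrum ℂ T = Metric.closedBall 0 1 := by
  apply Set.Subset.antisymm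
  · intro z hz
    have hTn : ‖T‖ ≤ 1 := norm_le_one_of_apply_le_comp T (Equiv.addRight 1) fun f n => by
      rw [hT]; split_ifs <;> simp
    simpa using (norm_le_of_mem_spectrum hz).trans hTn
  · rw [← closure_ball (0 : ℂ) one_ne_zero]
    exact closure_minimal (fun z hz => mem_spectrum_truncated_shift hT (by simpa using hz))
      (spectrum.isClosed T)

theorem hausdorffDist_sphere_closedBall :
    Metric.hausdorffDist (Metric.sphere (0 : ℂ) 1) (Metric.closedBall 0 1) = 1 := by
  apply le_antisymm
  · refine Metric.hausdorffDist_le_of_mem_dist zero_le_one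
      (fun x hx => ⟨x, Metric.sphere_subset_closedBall hx, by simp⟩) fun x hx => ?_
    by_cases h : x = 0
    · exact ⟨1, by simp, by simp [h]⟩
    · have hx : ‖x‖ ≤ 1 := by simpa using hx
      have hpos : 0 < ‖x‖ := norm_pos_iff.mpr h
      have hn : (‖x‖ : ℂ) ≠ 0 := by exact_mod_cast hpos.ne'
      have hunit : ‖(‖x‖ : ℂ)⁻¹ * x‖ = 1 := by simp [h]
      refine ⟨(‖x‖ : ℂ)⁻¹ * x, by simpa using hunit, ?_⟩
      rw [dist_eq_norm, show x - (‖x‖ : ℂ)⁻¹ * x = ((‖x‖ - 1 : ℝ) : ℂ) * ((‖x‖ : ℂ)⁻¹ * x) by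
        push_cast; field_simp, norm_mul, hunit, mul_one, Complex.norm_real, Real.norm_eq_abs,
        abs_le]
      constructor <;> linarith
  · have hne : (Metric.sphere (0 : ℂ) 1).Nonempty := ⟨1, by simp⟩
    rw [Metric.hausdorffDist_comm]
    refine le_trans ?_ (Metric.infDist_le_hausdorffDist_of_mem
      (Metric.mem_closedBall_self zero_le_one)
      (Metric.hausdorffEDist_ne_top_of_nonempty_of_bounded ⟨0, by simp⟩ hne
        Metric.isBounded_closedBall Metric.isBounded_sphere))
    exact (Metric.le_infDist hne).mpr fun {y} hy => by
      rw [dist_comm, Metric.mem_sphere.mp hy]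

theorem norm_perturbed_shift_sub_truncated_shift {ε : ℝ} (hε0 : 0 ≤ ε)
    {Tε T₀ : lp (fun _ : ℤ => ℂ) 2 →L[ℂ] lp (fun _ : ℤ => ℂ) 2}
    (hTε : ∀ (f : lp (fun _ : ℤ => ℂ) 2) (n : ℤ),
      Tε f n = if n = 0 then (ε : ℂ) * f 1 else f (n + 1))
    (hT₀ : ∀ (f : lp (fun _ : ℤ => ℂ) 2) (n : ℤ),
      T₀ f n = if n = 0 then 0 else f (n + 1)) :
    ‖Tε - T₀‖ = ε := by
  have happ (f : lp (fun _ : ℤ => ℂ) 2) (n : ℤ) :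
      (Tε - T₀) f n = if n = 0 then (ε : ℂ) * f 1 else 0 := by
    have : (Tε - T₀) f n = Tε f n - T₀ f n := rfl
    rw [this, hTε, hT₀]
    split_ifs <;> simp
  apply le_antisymm
  · refine (Tε - T₀).opNorm_le_bound hε0 fun f =>
      norm_le_of_apply_le_comp hε0 (Equiv.addRight 1) fun n => ?_
    rw [happ]
    split_ifs with h
    · simp [h, abs_of_nonneg hε0]
    · rw [norm_zero]; positivity
  · have h1 := (Tε - T₀).le_opNorm (lp.single 2 1 1)
    have h2 := lp.norm_apply_le_norm two_ne_zero ((Tε - T₀) (lp.single 2 1 1)) 0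
    rw [happ] at h2
    rw [lp.norm_single (by norm_num)] at h1
    simp [abs_of_nonneg hε0] at h1 h2
    exact h2.trans h1

/-!
For ε ≥ 0, `T_ε` is the bounded operator on ℓ²(ℤ) with
`(T_ε f)(n) = ε·f(1)` if `n = 0` and `(T_ε f)(n) = f(n+1)` otherwise.
STATEMENT 2: for 0 < ε ≤ 1, `‖T_ε − T_0‖ = ε` while the Hausdorff distance
between `spec(T_ε)` and `spec(T_0)` equals 1 (spectral instability).
-/

theorem spectral_instability_of_shift
    (ε : ℝ) (hε0 : 0 < ε) (hε1 : ε ≤ 1)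
    (Tε T₀ : lp (fun _ : ℤ => ℂ) 2 →L[ℂ] lp (fun _ : ℤ => ℂ) 2)
    (hTε : ∀ (f : lp (fun _ : ℤ => ℂ) 2) (n : ℤ),
      Tε f n = if n = 0 then (ε : ℂ) * f 1 else f (n + 1))
    (hT₀ : ∀ (f : lp (fun _ : ℤ => ℂ) 2) (n : ℤ),
      T₀ f n = if n = 0 then 0 else f (n + 1)) :
    ‖Tε - T₀‖ = ε ∧
      Metric.hausdorffDist (spectrum ℂ Tε) (spectrum ℂ T₀) = 1 := by
  refine ⟨norm_perturbed_shift_sub_truncated_shift hε0.le hTε hT₀, ?_⟩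
  rw [(spectrum_perturbed_shift_subset hε0 hTε).antisymm
    (sphere_subset_spectrum_perturbed_shift hTε), spectrum_truncated_shift hT₀]
  exact hausdorffDist_sphere_closedBall
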